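/- arXiv:math/9809086 — 6 statements merged into one kernel-verified Lean document; each statement's English description precedes it below -/
import Mathlib

section
/- Let q ∈ ℂ be nonzero and not a root of unity, and let n be a natural number. Then $\sum_{m=1}^{n}\frac{1}{1-q^{2m}}\sum_{k=0}^{m}\binom{n}{k}_{q^2}\,(-1)^{m-k}\,q^{2(m-k)}\,q^{(m-k)(m-k-1)}\binom{n-k}{m-k}_{q^{2}} = n$. (This is the value of the Chern–Connes pairing $(\tau^1\circ Tr)(e_{n})$, showing the left Chern number of the quantum Hopf line bundle of winding number $n$ equals $n$.) -/
/-- The `x`-binomial coefficient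
`(x-1)(x²-1)⋯(xⁿ-1) / [(x-1)⋯(x^k-1) · (x-1)⋯(x^(n-k)-1)]`. -/
noncomputable def qbin (x : ℂ) (n k : ℕ) : ℂ :=
  (∏ i ∈ Finset.range n, (x ^ (i + 1) - 1)) /
    ((∏ i ∈ Finset.range k, (x ^ (i + 1) - 1)) *
      (∏ i ∈ Finset.range (n - k), (x ^ (i + 1) - 1)))

open Finset

/-- The denominators `(x-1)(x²-1)⋯(xⁿ-1)` of `qbin x` do not vanish. -/
theorem prod_pow_sub_one_ne_zero {x : ℂ} (hx : ∀ k : ℕ, 0 < k → x ^ k ≠ 1) (n : ℕ) :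
    ∏ i ∈ range n, (x ^ (i + 1) - 1) ≠ 0 :=
  prod_ne_zero_iff.2 fun i _ => sub_ne_zero.2 (hx (i + 1) i.succ_pos)

theorem qbin_zero_right {x : ℂ} (hx : ∀ k : ℕ, 0 < k → x ^ k ≠ 1) (n : ℕ) :
    qbin x n 0 = 1 := by
  simp [qbin, div_self (prod_pow_sub_one_ne_zero hx n)]

theorem qbin_self {x : ℂ} (hx : ∀ k : ℕ, 0 < k → x ^ k ≠ 1) (n : ℕ) :
    qbin x n n = 1 := by
  simp [qbin, div_self (prod_pow_sub_one_ne_zero hx n)]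

theorem qbin_symm (x : ℂ) {n k : ℕ} (h : k ≤ n) : qbin x n (n - k) = qbin x n k := by
  rw [qbin, qbin, Nat.sub_sub_self h, mul_comm (∏ i ∈ range (n - k), _)]

/-- The Pascal rule for `x`-binomial coefficients. -/
theorem qbin_succ_succ {x : ℂ} (hx : ∀ k : ℕ, 0 < k → x ^ k ≠ 1) {n k : ℕ} (h : k < n) :
    qbin x (n + 1) (k + 1) = qbin x n (k + 1) + x ^ (n - k) * qbin x n k := by
  obtain ⟨d, rfl⟩ := Nat.exists_eq_add_of_lt h
  have e1 : k + d + 1 + 1 - (k + 1) = d + 1 := by omega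
  have e2 : k + d + 1 - (k + 1) = d := by omega
  have e3 : k + d + 1 - k = d + 1 := by omega
  have hk := prod_pow_sub_one_ne_zero hx k
  have hd := prod_pow_sub_one_ne_zero hx d
  have hk1 := sub_ne_zero.2 (hx (k + 1) k.succ_pos)
  have hd1 := sub_ne_zero.2 (hx (d + 1) d.succ_pos)
  simp only [qbin, e1, e2, e3]
  rw [prod_range_succ _ (k + d + 1), prod_range_succ _ k, prod_range_succ _ d]
  field_simp
  ring

theorem qbin_mul_qbin {x : ℂ} (hx : ∀ k : ℕ, 0 < k → x ^ k ≠ 1) {n m k : ℕ}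
    (hkm : k ≤ m) (hmn : m ≤ n) :
    qbin x n k * qbin x (n - k) (m - k) = qbin x n m * qbin x m k := by
  have e : n - k - (m - k) = n - m := by omega
  have := prod_pow_sub_one_ne_zero hx
  have h1 := this k
  have h2 := this (m - k)
  have h3 := this (n - m)
  have h4 := this m
  have h5 := this (n - k)
  simp only [qbin, e]
  field_simp

/-- The `x`-binomial theorem. -/
theorem sum_qbin_mul_pow {x : ℂ} (hx : ∀ k : ℕ, 0 < k → x ^ k ≠ 1) (z : ℂ) (m : ℕ) :
    ∑ j ∈ range (m + 1), z ^ j * x ^ j.choose 2 * qbin x m j =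
      ∏ i ∈ range m, (1 + z * x ^ i) := by
  induction m with
  | zero => simp [qbin]
  | succ m ih =>
    have step : ∀ j ∈ range m,
        z ^ (j + 1) * x ^ (j + 1).choose 2 * qbin x (m + 1) (j + 1) =
          z ^ (j + 1) * x ^ (j + 1).choose 2 * qbin x m (j + 1) +
            z * x ^ m * (z ^ j * x ^ j.choose 2 * qbin x m j) := by
      intro j hj
      have hj := mem_range.1 hj
      have e : x ^ (j + 1).choose 2 * x ^ (m - j) = x ^ m * x ^ j.choose 2 := by
        have c : (j + 1).choose 2 = j + j.choose 2 := by
          rw [Nat.choose_succ_succ' j 1, Nat.choose_one_right]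
        rw [← pow_add, ← pow_add, c]
        congr 1
        omega
      rw [qbin_succ_succ hx hj]
      linear_combination z ^ (j + 1) * qbin x m j * e
    have top : z ^ (m + 1) * x ^ (m + 1).choose 2 =
        z * x ^ m * (z ^ m * x ^ m.choose 2) := by
      rw [Nat.choose_succ_succ' m 1, Nat.choose_one_right]
      ring
    have shifted := sum_range_succ' (fun j => z ^ j * x ^ j.choose 2 * qbin x m j) m
    have last := sum_range_succ (fun j => z ^ j * x ^ j.choose 2 * qbin x m j) m
    rw [qbin_zero_right hx] at shifted
    rw [qbin_self hx] at last
    rw [prod_range_succ, ← ih, sum_range_succ, sum_range_succ', sum_congr rfl step,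
      sum_add_distrib, ← mul_sum, qbin_self hx, qbin_zero_right hx, top]
    linear_combination -shifted - z * x ^ m * last

theorem qbin_mul_prod {x : ℂ} (hx : ∀ k : ℕ, 0 < k → x ^ k ≠ 1) {n m : ℕ} (h : m ≤ n) :
    qbin x n m * ∏ i ∈ range m, (1 - x ^ (i + 1)) = ∏ i ∈ range m, (1 - x ^ (n - i)) := by
  induction m with
  | zero => simp [qbin_zero_right hx]
  | succ m ih =>
    rw [prod_range_succ, prod_range_succ, ← ih (by omega)]
    obtain ⟨d, rfl⟩ := Nat.exists_eq_add_of_lt h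
    have e2 : m + d + 1 - (m + 1) = d := by omega
    have e3 : m + d + 1 - m = d + 1 := by omega
    have hm := prod_pow_sub_one_ne_zero hx m
    have hd := prod_pow_sub_one_ne_zero hx d
    have hm1 := sub_ne_zero.2 (hx (m + 1) m.succ_pos)
    have hd1 := sub_ne_zero.2 (hx (d + 1) d.succ_pos)
    simp only [qbin, e2, e3]
    rw [prod_range_succ (fun i => x ^ (i + 1) - 1) m, prod_range_succ _ d]
    field_simp
    ring

theorem sum_prod_one_sub_pow_div {x : ℂ} (hx : ∀ k : ℕ, 0 < k → x ^ k ≠ 1) (n : ℕ) :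
    ∑ m ∈ range n, (∏ i ∈ range (m + 1), (1 - x ^ (n - i))) / (1 - x ^ (m + 1)) = n := by
  induction n with
  | zero => simp
  | succ n ih =>
    have step : ∀ m ∈ range (n + 1),
        (∏ i ∈ range (m + 1), (1 - x ^ (n + 1 - i))) / (1 - x ^ (m + 1)) =
          (∏ i ∈ range (m + 1), (1 - x ^ (n - i))) / (1 - x ^ (m + 1)) +
            ((∏ i ∈ range m, (1 - x ^ (n - i))) -
              ∏ i ∈ range (m + 1), (1 - x ^ (n - i))) := by
      intro m hm
      have hm : m ≤ n := Nat.lt_succ_iff.1 (mem_range.1 hm)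
      have hm1 := sub_ne_zero.2 (hx (m + 1) m.succ_pos).symm
      have e : x ^ (n + 1) = x ^ (n - m) * x ^ (m + 1) := by
        rw [← pow_add]
        congr 1
        omega
      rw [prod_range_succ' (fun i => 1 - x ^ (n + 1 - i)), prod_range_succ]
      simp only [Nat.add_sub_add_right, Nat.sub_zero, e]
      field_simp
      ring
    have vanish : ∏ i ∈ range (n + 1), (1 - x ^ (n - i)) = 0 :=
      prod_eq_zero (self_mem_range_succ n) (by simp)
    rw [sum_congr rfl step, sum_add_distrib, sum_range_sub', sum_range_succ, ih, vanish]
    simp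

theorem sum_qbin_mul_qbin {q : ℂ} (hx : ∀ k : ℕ, 0 < k → (q ^ 2) ^ k ≠ 1) {n m : ℕ}
    (h : m ≤ n) :
    ∑ k ∈ range (m + 1),
      qbin (q ^ 2) n k * (-1 : ℂ) ^ (m - k) * q ^ (2 * (m - k)) *
        q ^ ((m - k) * (m - k - 1)) * qbin (q ^ 2) (n - k) (m - k) =
      ∏ i ∈ range m, (1 - (q ^ 2) ^ (n - i)) := by
  have term : ∀ k ∈ range (m + 1),
      qbin (q ^ 2) n k * (-1 : ℂ) ^ (m - k) * q ^ (2 * (m - k)) *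
        q ^ ((m - k) * (m - k - 1)) * qbin (q ^ 2) (n - k) (m - k) =
      qbin (q ^ 2) n m * ((-q ^ 2) ^ (m - k) * (q ^ 2) ^ (m - k).choose 2 *
        qbin (q ^ 2) m (m - k)) := by
    intro k hk
    have hk : k ≤ m := Nat.lt_succ_iff.1 (mem_range.1 hk)
    have e : q ^ ((m - k) * (m - k - 1)) = (q ^ 2) ^ (m - k).choose 2 := by
      rw [← pow_mul, Nat.choose_two_right,
        Nat.mul_div_cancel' (Nat.even_mul_pred_self _).two_dvd]
    rw [e, qbin_symm _ hk, neg_pow (q ^ 2), pow_mul]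
    linear_combination (-1) ^ (m - k) * (q ^ 2) ^ (m - k) * (q ^ 2) ^ (m - k).choose 2 *
      qbin_mul_qbin hx hk h
  rw [sum_congr rfl term, ← mul_sum, ← qbin_mul_prod hx h]
  congr 1
  have reflect := sum_range_reflect
    (fun j => (-q ^ 2) ^ j * (q ^ 2) ^ j.choose 2 * qbin (q ^ 2) m j) (m + 1)
  simp only [Nat.add_sub_cancel] at reflect
  rw [reflect, sum_qbin_mul_pow hx]
  exact prod_congr rfl fun i _ => by ring

theorem stmt1 (q : ℂ) (hq : q ≠ 0) (hroot : ∀ k : ℕ, 0 < k → q ^ k ≠ 1) (n : ℕ) :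
    ∑ m ∈ Finset.Icc 1 n,
      (1 / (1 - q ^ (2 * m))) *
        ∑ k ∈ Finset.range (m + 1),
          qbin (q ^ 2) n k * (-1 : ℂ) ^ (m - k) * q ^ (2 * (m - k)) *
            q ^ ((m - k) * (m - k - 1)) * qbin (q ^ 2) (n - k) (m - k)
      = (n : ℂ) := by
  have hx : ∀ k : ℕ, 0 < k → (q ^ 2) ^ k ≠ 1 := fun k hk => by
    rw [← pow_mul]
    exact hroot (2 * k) (by omega)
  rw [← sum_prod_one_sub_pow_div hx n, range_eq_Ico, sum_Ico_add' (fun m =>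
    (∏ i ∈ range m, (1 - (q ^ 2) ^ (n - i))) / (1 - (q ^ 2) ^ m)) 0 n 1]
  refine sum_congr rfl fun m hm => ?_
  rw [sum_qbin_mul_qbin hx (mem_Icc.1 hm).2, pow_mul, one_div_mul_eq_div]
end

section
/- Let q ∈ ℂ be nonzero and not a root of unity, let A be a unital associative ℂ-algebra, and let a, b, c, d ∈ A satisfy the SL_q(2) relations. Set ζ := −q⁻¹bc. Then for every natural number n, $\sum_{k=0}^{n}\binom{n}{k}_{q^2}\,(-q)^{k}\,a^{n-k}c^{k}b^{k}d^{n-k} \;=\; \sum_{k=0}^{n}\binom{n}{k}_{q^2}\,q^{-2k(n-k-1)}\,\zeta^{k}\prod_{l=0}^{n-k-1}(1-q^{-2l}\zeta)$, where the empty product (for k = n) is 1. (This computes the matrix trace of the projector $e_{-n}$ of the quantum Hopf line bundle of winding number $-n$ as a polynomial in ζ.) -/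
theorem pow_mul_pow_of_mul_eq_zpow_smul {A : Type*} [Ring A] [Algebra ℂ A] {q : ℂ} (hq : q ≠ 0)
    {a z : A} (h : a * z = q ^ (-2 : ℤ) • (z * a)) (m k : ℕ) :
    a ^ m * z ^ k = q ^ ((-2 : ℤ) * k * m) • (z ^ k * a ^ m) := by
  have hk : ∀ k : ℕ, a * z ^ k = q ^ ((-2 : ℤ) * k) • (z ^ k * a) := by
    intro k
    induction k with
    | zero => simp
    | succ k ih =>
      rw [pow_succ, ← mul_assoc, ih, smul_mul_assoc, mul_assoc, h, mul_smul_comm, smul_smul,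
        ← zpow_add₀ hq, ← mul_assoc]
      congr 2
      push_cast
      ring
  induction m with
  | zero => simp
  | succ m ih =>
    rw [pow_succ, mul_assoc, hk, mul_smul_comm, ← mul_assoc, ih, smul_mul_assoc, smul_smul,
      ← zpow_add₀ hq, mul_assoc (z ^ k)]
    congr 2
    push_cast
    ring

theorem pow_mul_pow_eq_prod_one_sub {A : Type*} [Ring A] [Algebra ℂ A] {q : ℂ} (hq : q ≠ 0)
    {a d z : A} (h : a * z = q ^ (-2 : ℤ) • (z * a)) (had : a * d = 1 - z) (m : ℕ) :
    a ^ m * d ^ m =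
      ((List.range m).map fun l : ℕ => (1 : A) - (q ^ ((-2 : ℤ) * l)) • z).prod := by
  induction m with
  | zero => simp
  | succ m ih =>
    have hz := pow_mul_pow_of_mul_eq_zpow_smul hq h m 1
    simp only [pow_one, Nat.cast_one, mul_one] at hz
    have hcomm : Commute ((1 : A) - (q ^ ((-2 : ℤ) * m)) • z)
        ((List.range m).map fun l : ℕ => (1 : A) - (q ^ ((-2 : ℤ) * l)) • z).prod := by
      refine Commute.list_prod_right _ _ fun y hy => ?_
      obtain ⟨l, -, rfl⟩ := List.mem_map.mp hy
      exact (Commute.one_left _).sub_left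
        ((Commute.one_right _).sub_right
          (((Commute.refl z).smul_left _).smul_right _))
    rw [List.range_succ, List.map_append, List.prod_append, List.map_singleton,
      List.prod_singleton, ← hcomm.eq, ← ih, pow_succ, pow_succ' d, mul_assoc,
      ← mul_assoc a, had, ← mul_assoc, mul_sub, mul_one, hz, sub_mul, sub_mul, one_mul,
      smul_mul_assoc, smul_mul_assoc, mul_assoc]

theorem stmt2 (q : ℂ) (hq : q ≠ 0) (hroot : ∀ k : ℕ, 0 < k → q ^ k ≠ 1)
    (A : Type*) [Ring A] [Algebra ℂ A] (a b c d : A)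
    (hab : a * b = q⁻¹ • (b * a)) (hac : a * c = q⁻¹ • (c * a))
    (hbd : b * d = q⁻¹ • (d * b)) (hbc : b * c = c * b)
    (hcd : c * d = q⁻¹ • (d * c))
    (hadda : a * d - d * a = (q⁻¹ - q) • (b * c))
    (had : a * d - q⁻¹ • (b * c) = 1) (hda : d * a - q • (b * c) = 1)
    (ζ : A) (hζ : ζ = (-q⁻¹) • (b * c)) (n : ℕ) :
    ∑ k ∈ Finset.range (n + 1),
      (qbin (q ^ 2) n k * (-q) ^ k) • (a ^ (n - k) * c ^ k * b ^ k * d ^ (n - k))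
    = ∑ k ∈ Finset.range (n + 1),
        (qbin (q ^ 2) n k * q ^ ((-2 : ℤ) * k * ((n : ℤ) - k - 1))) •
          (ζ ^ k * ((List.range (n - k)).map fun l =>
            (1 : A) - (q ^ ((-2 : ℤ) * l)) • ζ).prod) := by
  have hbcz : c * b = (-q) • ζ := by
    rw [hζ, smul_smul, ← hbc]
    simp [hq]
  have haz : a * ζ = q ^ (-2 : ℤ) • (ζ * a) := by
    rw [hζ, mul_smul_comm, ← mul_assoc, hab, smul_mul_assoc, mul_assoc, hac, mul_smul_comm,
      smul_smul, smul_smul, smul_mul_assoc, smul_smul, ← mul_assoc]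
    congr 1
    rw [zpow_neg, zpow_ofNat]
    field_simp
  have hadz : a * d = 1 - ζ := by
    rw [hζ, neg_smul, sub_neg_eq_add, ← had, sub_add_cancel]
  refine Finset.sum_congr rfl fun k hk => ?_
  have hkn : k ≤ n := Nat.lt_succ_iff.mp (Finset.mem_range.mp hk)
  have hcb : c ^ k * b ^ k = (-q) ^ k • ζ ^ k := by
    rw [← Commute.mul_pow hbc.symm, hbcz, smul_pow]
  have hprod := pow_mul_pow_eq_prod_one_sub hq haz hadz (n - k)
  simp only [List.pure_def, List.bind_eq_flatMap, ← List.map_eq_flatMap, List.map_map,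
    Function.comp_def]
  rw [← hprod, mul_assoc (a ^ (n - k)), hcb, mul_smul_comm,
    pow_mul_pow_of_mul_eq_zpow_smul hq haz, smul_mul_assoc, smul_mul_assoc, smul_smul, smul_smul,
    mul_assoc (ζ ^ k)]
  congr 1
  have hqk : (-q) ^ k * (-q) ^ k = q ^ ((2 : ℤ) * k) := by
    rw [← mul_pow, neg_mul_neg, ← pow_two, ← pow_mul]
    exact_mod_cast (zpow_natCast q (2 * k)).symm
  rw [mul_assoc, mul_assoc, ← mul_assoc ((-q) ^ k), hqk, ← zpow_add₀ hq, Nat.cast_sub hkn]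
  congr 2
  ring
end

section
/- Let q ∈ ℂ be nonzero and not a root of unity, let A be a unital associative ℂ-algebra, and let a, b, c, d ∈ A satisfy the SL_q(2) relations. Set ζ := −q⁻¹bc. Then for every natural number n, $\sum_{k=0}^{n}\binom{n}{k}_{q^2}\,(-q)^{-k}\,b^{k}d^{n-k}a^{n-k}c^{k} \;=\; \sum_{k=0}^{n}\binom{n}{k}_{q^2}\,\zeta^{k}\prod_{l=0}^{n-k-1}(1-q^{2(l+1)}\zeta)$, where the empty product (for k = n) is 1. (This computes the matrix trace of the projector $e_{n}$ of the quantum Hopf line bundle of winding number $n$ as a polynomial in ζ.) -/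
/-- If `ζ * a = r • (a * ζ)` then `ζ * a ^ m = r ^ m • (a ^ m * ζ)`. -/
theorem mul_pow_of_mul_eq_smul {R A : Type*} [CommRing R] [Ring A] [Algebra R A] {r : R}
    {ζ a : A} (h : ζ * a = r • (a * ζ)) (m : ℕ) : ζ * a ^ m = r ^ m • (a ^ m * ζ) := by
  induction m with
  | zero => simp
  | succ m ih =>
    rw [pow_succ a, ← mul_assoc, ih, smul_mul_assoc, mul_assoc, h, mul_smul_comm, smul_smul,
      ← mul_assoc, pow_succ r]

/-- If `d * a = 1 - q² ζ` and `ζ * a = q² a * ζ`, then `d ^ m * a ^ m` is a `q`-shifted factorial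
in `ζ`. -/
theorem pow_mul_pow_eq_prod {R A : Type*} [CommRing R] [Ring A] [Algebra R A] {q : R}
    {ζ a d : A} (hζa : ζ * a = q ^ 2 • (a * ζ)) (hda : d * a = 1 - q ^ 2 • ζ) (m : ℕ) :
    d ^ m * a ^ m =
      ((List.range m).map fun l => (1 : A) - (q ^ (2 * (l + 1))) • ζ).prod := by
  induction m with
  | zero => simp
  | succ m ih =>
    have hshift : (1 - q ^ 2 • ζ) * a ^ m = a ^ m * (1 - q ^ (2 * (m + 1)) • ζ) := by
      rw [sub_mul, mul_sub, one_mul, mul_one, smul_mul_assoc, mul_pow_of_mul_eq_smul hζa,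
        smul_smul, mul_smul_comm, ← pow_mul, ← pow_add]
      congr 3
      ring
    rw [List.range_succ, List.map_append, List.prod_append, ← ih, pow_succ d, pow_succ' a]
    calc d ^ m * d * (a * a ^ m) = d ^ m * ((d * a) * a ^ m) := by simp only [mul_assoc]
      _ = _ := by rw [hda, hshift]; simp [mul_assoc]

theorem stmt3 (q : ℂ) (hq : q ≠ 0) (hroot : ∀ k : ℕ, 0 < k → q ^ k ≠ 1)
    (A : Type*) [Ring A] [Algebra ℂ A] (a b c d : A)
    (hab : a * b = q⁻¹ • (b * a)) (hac : a * c = q⁻¹ • (c * a))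
    (hbd : b * d = q⁻¹ • (d * b)) (hbc : b * c = c * b)
    (hcd : c * d = q⁻¹ • (d * c))
    (hadda : a * d - d * a = (q⁻¹ - q) • (b * c))
    (had : a * d - q⁻¹ • (b * c) = 1) (hda : d * a - q • (b * c) = 1)
    (ζ : A) (hζ : ζ = (-q⁻¹) • (b * c)) (n : ℕ) :
    ∑ k ∈ Finset.range (n + 1),
      (qbin (q ^ 2) n k * (-q) ^ (-(k : ℤ))) • (b ^ k * d ^ (n - k) * a ^ (n - k) * c ^ k)
    = ∑ k ∈ Finset.range (n + 1),
        (qbin (q ^ 2) n k) •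
          (ζ ^ k * ((List.range (n - k)).map fun l =>
            (1 : A) - (q ^ (2 * (l + 1))) • ζ).prod) := by
  have hbcζ : b * c = (-q) • ζ := by
    rw [hζ, smul_smul, neg_mul_neg, mul_inv_cancel₀ hq, one_smul]
  have hda' : d * a = 1 - q ^ 2 • ζ := by
    rw [sub_eq_iff_eq_add.mp hda, hbcζ, smul_smul, sub_eq_add_neg, ← neg_smul]
    congr 2
    ring
  have hba : b * a = q • (a * b) := by rw [hab, smul_smul, mul_inv_cancel₀ hq, one_smul]
  have hca : c * a = q • (a * c) := by rw [hac, smul_smul, mul_inv_cancel₀ hq, one_smul]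
  have hζa : ζ * a = q ^ 2 • (a * ζ) := by
    have h : b * c * a = q ^ 2 • (a * (b * c)) := by
      rw [mul_assoc, hca, mul_smul_comm, ← mul_assoc, hba, smul_mul_assoc, smul_smul, mul_assoc,
        ← pow_two]
    rw [hζ, smul_mul_assoc, h, mul_smul_comm, smul_comm]
  have hcζ : Commute c ζ := by
    rw [hζ]
    exact ((show Commute c b from hbc.symm).mul_right (Commute.refl c)).smul_right _
  refine Finset.sum_congr rfl fun k _ => ?_
  have hcomm (x : A) (hx : Commute x ζ) (m : ℕ) :
      Commute x ((List.range m).map fun l => (1 : A) - (q ^ (2 * (l + 1))) • ζ).prod := by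
    refine Commute.list_prod_right _ _ fun y hy => ?_
    obtain ⟨l, -, rfl⟩ := List.mem_map.mp hy
    exact (Commute.one_right x).sub_right (hx.smul_right _)
  rw [mul_assoc (b ^ k), pow_mul_pow_eq_prod hζa hda', mul_assoc,
    ← ((hcomm c hcζ (n - k)).pow_left k).eq, ← mul_assoc,
    ← (show Commute b c from hbc).mul_pow, hbcζ, smul_pow, smul_mul_assoc, smul_smul, mul_assoc,
    zpow_neg, zpow_natCast, inv_mul_cancel₀ (pow_ne_zero k (neg_ne_zero.mpr hq)), mul_one]
end

section
/- Let n ≥ m ≥ 1 be integers. Then, as real q tends to +∞, $\frac{(-1)^{m}}{1-q^{2m}}\sum_{k=0}^{m}\binom{n}{k}_{q^2}\,q^{-2k(n-k-1)}\,(-1)^{k}\,q^{-(m-k)(m-k-1)}\binom{n-k}{m-k}_{q^{-2}} \;\longrightarrow\; -1$. (This is the asymptotic evaluation used to compute the left Chern number of the quantum Hopf line bundle of winding number $-n$.) -/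
/-- The real `x`-binomial coefficient
`(x-1)(x²-1)⋯(xⁿ-1) / [(x-1)⋯(x^k-1) · (x-1)⋯(x^(n-k)-1)]`. -/
noncomputable def qbinR (x : ℝ) (n k : ℕ) : ℝ :=
  (∏ i ∈ Finset.range n, (x ^ (i + 1) - 1)) /
    ((∏ i ∈ Finset.range k, (x ^ (i + 1) - 1)) *
      (∏ i ∈ Finset.range (n - k), (x ^ (i + 1) - 1)))

theorem sum_range_succ_add (k j : ℕ) :
    ∑ i ∈ Finset.range (k + j), (i + 1) =
      (∑ i ∈ Finset.range k, (i + 1)) + (∑ i ∈ Finset.range j, (i + 1)) + k * j := by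
  induction j with
  | zero => simp
  | succ j ih =>
    rw [← add_assoc, Finset.sum_range_succ, ih, Finset.sum_range_succ _ j]
    ring

theorem prod_pow_sub_one_eq_inv {x : ℝ} (hx : x ≠ 0) (n : ℕ) :
    ∏ i ∈ Finset.range n, (x ^ (i + 1) - 1) =
      (-1) ^ n * x ^ (∑ i ∈ Finset.range n, (i + 1)) *
        ∏ i ∈ Finset.range n, (x⁻¹ ^ (i + 1) - 1) := by
  rw [← Finset.prod_pow_eq_pow_sum, ← Finset.card_range n, ← Finset.prod_const,
    Finset.card_range, ← Finset.prod_mul_distrib, ← Finset.prod_mul_distrib]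
  refine Finset.prod_congr rfl fun i _ => ?_
  have h : x ^ (i + 1) * x⁻¹ ^ (i + 1) = 1 := by
    rw [← mul_pow, mul_inv_cancel₀ hx, one_pow]
  linear_combination h

/-- Inversion of the base of an `x`-binomial coefficient. -/
theorem qbinR_eq_pow_mul_qbinR_inv {x : ℝ} (hx : x ≠ 0) {n k : ℕ} (hk : k ≤ n) :
    qbinR x n k = x ^ (k * (n - k)) * qbinR x⁻¹ n k := by
  obtain ⟨j, rfl⟩ := Nat.exists_eq_add_of_le hk
  unfold qbinR
  rw [prod_pow_sub_one_eq_inv hx (k + j), prod_pow_sub_one_eq_inv hx k,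
    prod_pow_sub_one_eq_inv hx (k + j - k), Nat.add_sub_cancel_left, sum_range_succ_add,
    mul_mul_mul_comm, mul_div_mul_comm]
  congr 1
  have h : (-1 : ℝ) ^ k ≠ 0 := by simp
  have h' : (-1 : ℝ) ^ j ≠ 0 := by simp
  field_simp
  ring

theorem tendsto_qbinR_nhds_zero {n k : ℕ} (hk : k ≤ n) :
    Filter.Tendsto (fun x => qbinR x n k) (nhds 0) (nhds 1) := by
  have hp (l : ℕ) : Filter.Tendsto (fun x : ℝ => ∏ i ∈ Finset.range l, (x ^ (i + 1) - 1))
      (nhds 0) (nhds ((-1) ^ l)) := by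
    have hc : Continuous fun x : ℝ => ∏ i ∈ Finset.range l, (x ^ (i + 1) - 1) := by fun_prop
    simpa using hc.tendsto 0
  have h := (hp n).div ((hp k).mul (hp (n - k))) (by simp)
  rw [← pow_add, Nat.add_sub_cancel' hk, div_self (by simp)] at h
  exact h

theorem tendsto_zpow_div_one_sub_pow {m : ℕ} (hm : 1 ≤ m) {e : ℤ} (he : e ≤ 2 * m) :
    Filter.Tendsto (fun q : ℝ => q ^ e / (1 - q ^ (2 * m))) Filter.atTop
      (nhds (if e = 2 * m then -1 else 0)) := by
  have hden : Filter.Tendsto (fun q : ℝ => q ^ (-(2 * m : ℤ)) - 1) Filter.atTop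
      (nhds (0 - 1)) :=
    (tendsto_zpow_atTop_zero (by omega)).sub_const 1
  have hnum : Filter.Tendsto (fun q : ℝ => q ^ (e - 2 * m)) Filter.atTop
      (nhds (if e = 2 * m then 1 else 0)) := by
    split_ifs with h
    · simp [h]
    · exact tendsto_zpow_atTop_zero (by omega)
  have h := hnum.div hden (by norm_num)
  have hl : (if e = 2 * m then (1 : ℝ) else 0) / (0 - 1) = if e = 2 * m then -1 else 0 := by
    split_ifs <;> norm_num
  rw [hl] at h
  refine h.congr' ?_
  filter_upwards [Filter.eventually_gt_atTop 0] with q hq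
  have hq2 : q ^ (2 * m) ≠ 0 := by positivity
  have hz : q ^ (2 * m : ℤ) = q ^ (2 * m) := by exact_mod_cast zpow_natCast q (2 * m)
  simp only [Pi.div_apply]
  rw [zpow_sub₀ hq.ne', zpow_neg, hz, ← mul_div_mul_right _ (1 - q ^ (2 * m)) (inv_ne_zero hq2)]
  congr 1
  field_simp

theorem stmt8 (n m : ℕ) (hm : 1 ≤ m) (hmn : m ≤ n) :
    Filter.Tendsto
      (fun q : ℝ =>
        ((-1 : ℝ) ^ m / (1 - q ^ (2 * m))) *
          ∑ k ∈ Finset.range (m + 1),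
            qbinR (q ^ 2) n k * q ^ ((-2 : ℤ) * k * ((n : ℤ) - k - 1)) * (-1 : ℝ) ^ k *
              q ^ (-(((m : ℤ) - k) * ((m : ℤ) - k - 1))) * qbinR (q ^ (-2 : ℤ)) (n - k) (m - k))
      Filter.atTop (nhds (-1)) := by
  have hinv : Filter.Tendsto (fun q : ℝ => q ^ (-2 : ℤ)) Filter.atTop (nhds 0) :=
    tendsto_zpow_atTop_zero (by norm_num)
  have hterm : ∀ k ∈ Finset.range (m + 1), Filter.Tendsto
      (fun q : ℝ => ((-1 : ℝ) ^ m / (1 - q ^ (2 * m))) *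
        (qbinR (q ^ 2) n k * q ^ ((-2 : ℤ) * k * ((n : ℤ) - k - 1)) * (-1 : ℝ) ^ k *
          q ^ (-(((m : ℤ) - k) * ((m : ℤ) - k - 1))) * qbinR (q ^ (-2 : ℤ)) (n - k) (m - k)))
      Filter.atTop (nhds (if k = m then -1 else 0)) := by
    intro k hk
    have hkm : k ≤ m := Nat.lt_succ_iff.mp (Finset.mem_range.mp hk)
    have hkn : k ≤ n := hkm.trans hmn
    obtain ⟨j, rfl⟩ := Nat.exists_eq_add_of_le hkm
    have hj : (0 : ℤ) ≤ j * (j + 1) := by positivity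
    have he : (2 * k - ((k + j : ℕ) - k : ℤ) * ((k + j : ℕ) - k - 1) : ℤ) ≤ 2 * (k + j : ℕ) := by
      push_cast
      linarith
    have hiff : (2 * k - ((k + j : ℕ) - k : ℤ) * ((k + j : ℕ) - k - 1) : ℤ) = 2 * (k + j : ℕ) ↔
        k = k + j := by
      push_cast
      constructor
      · intro h
        have h0 : (j : ℤ) * (j + 1) = 0 := by linarith
        rcases mul_eq_zero.mp h0 with h1 | h1 <;> omega
      · intro h
        obtain rfl : j = 0 := by omega
        simp
    have h := (((tendsto_zpow_div_one_sub_pow hm he).const_mul ((-1 : ℝ) ^ (k + j) * (-1) ^ k)).mul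
      ((tendsto_qbinR_nhds_zero hkn).comp hinv)).mul
      ((tendsto_qbinR_nhds_zero (Nat.sub_le_sub_right hmn k)).comp hinv)
    have hl : (-1 : ℝ) ^ (k + j) * (-1) ^ k * (if (2 * k - ((k + j : ℕ) - k : ℤ) *
        ((k + j : ℕ) - k - 1) : ℤ) = 2 * (k + j : ℕ) then -1 else 0) * 1 * 1 =
        if k = k + j then -1 else 0 := by
      simp only [hiff]
      split_ifs with h
      · rw [← h, ← mul_pow]
        simp
      · simp
    rw [hl] at h
    refine h.congr' ?_
    filter_upwards [Filter.eventually_gt_atTop 0] with q hq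
    have hq2 : (q ^ 2)⁻¹ = q ^ (-2 : ℤ) := by rw [zpow_neg]; norm_cast
    have hpow : (q ^ 2) ^ (k * (n - k)) = q ^ (2 * k * ((n : ℤ) - k)) := by
      rw [← pow_mul, ← zpow_natCast]
      push_cast [Nat.cast_sub hkn]
      ring_nf
    have hexp : q ^ (2 * k - ((k + j : ℕ) - k : ℤ) * ((k + j : ℕ) - k - 1) : ℤ) =
        q ^ (2 * k * ((n : ℤ) - k)) * q ^ ((-2 : ℤ) * k * ((n : ℤ) - k - 1)) *
          q ^ (-(((k + j : ℕ) - k : ℤ) * ((k + j : ℕ) - k - 1))) := by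
      rw [← zpow_add₀ hq.ne', ← zpow_add₀ hq.ne']
      congr 1
      ring
    rw [qbinR_eq_pow_mul_qbinR_inv (pow_ne_zero 2 hq.ne') hkn, hq2, hpow, hexp]
    simp only [Function.comp_apply]
    ring
  have h := tendsto_finsetSum _ hterm
  simpa [Finset.mul_sum, Finset.sum_ite_eq'] using h
end

section
/- Let n ≥ m ≥ 1 be integers. Then, as real q tends to 0 from the right, $\frac{1}{1-q^{2m}}\sum_{k=0}^{m}\binom{n}{k}_{q^2}\,(-1)^{m-k}\,q^{2(m-k)}\,q^{(m-k)(m-k-1)}\binom{n-k}{m-k}_{q^{2}} \;\longrightarrow\; 1$. (This is the asymptotic evaluation used to compute the left Chern number of the quantum Hopf line bundle of winding number $n$.) -/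
lemma qbinR_zero_base {n k : ℕ} (h : k ≤ n) : qbinR 0 n k = 1 := by
  simp [qbinR, ← pow_add, Nat.add_sub_cancel' h]

lemma continuousAt_qbinR_zero (n k : ℕ) : ContinuousAt (fun x => qbinR x n k) 0 := by
  unfold qbinR
  refine ContinuousAt.div (by fun_prop) (by fun_prop) ?_
  simp

lemma continuousAt_qbinR_sq_zero (n k : ℕ) :
    ContinuousAt (fun q : ℝ => qbinR (q ^ 2) n k) 0 :=
  ContinuousAt.comp_of_eq (continuousAt_qbinR_zero n k) (by fun_prop) (by simp)

theorem stmt9 (n m : ℕ) (hm : 1 ≤ m) (hmn : m ≤ n) :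
    Filter.Tendsto
      (fun q : ℝ =>
        (1 / (1 - q ^ (2 * m))) *
          ∑ k ∈ Finset.range (m + 1),
            qbinR (q ^ 2) n k * (-1 : ℝ) ^ (m - k) * q ^ (2 * (m - k)) *
              q ^ ((m - k) * (m - k - 1)) * qbinR (q ^ 2) (n - k) (m - k))
      (nhdsWithin 0 (Set.Ioo (0 : ℝ) 1)) (nhds 1) := by
  have hm0 : 2 * m ≠ 0 := by lia
  refine Filter.Tendsto.mono_left ?_ nhdsWithin_le_nhds
  have hcont : ContinuousAt (fun q : ℝ =>
        (1 / (1 - q ^ (2 * m))) *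
          ∑ k ∈ Finset.range (m + 1),
            qbinR (q ^ 2) n k * (-1 : ℝ) ^ (m - k) * q ^ (2 * (m - k)) *
              q ^ ((m - k) * (m - k - 1)) * qbinR (q ^ 2) (n - k) (m - k)) 0 := by
    refine ContinuousAt.mul ?_ (tendsto_finsetSum _ fun k _ => ?_)
    · exact ContinuousAt.div (by fun_prop) (by fun_prop) (by simp [zero_pow hm0])
    · have h₁ := continuousAt_qbinR_sq_zero n k
      have h₂ := continuousAt_qbinR_sq_zero (n - k) (m - k)
      exact ContinuousAt.mul (by fun_prop) h₂
  convert hcont.tendsto using 2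
  have hsum : ∑ k ∈ Finset.range m,
      qbinR ((0 : ℝ) ^ 2) n k * (-1 : ℝ) ^ (m - k) * 0 ^ (2 * (m - k)) *
        0 ^ ((m - k) * (m - k - 1)) * qbinR (0 ^ 2) (n - k) (m - k) = 0 := by
    refine Finset.sum_eq_zero fun k hk => ?_
    have : 2 * (m - k) ≠ 0 := by have := Finset.mem_range.mp hk; lia
    simp [zero_pow this]
  rw [Finset.sum_range_succ, hsum]
  simp [zero_pow hm0, qbinR_zero_base hmn, qbinR_zero_base (Nat.zero_le (n - m))]
end

section
/- Let q ∈ ℂ be nonzero and not a root of unity, let A be a unital associative ℂ-algebra, and let a, b, c, d ∈ A satisfy the SL_q(2) relations. For a natural number n, define the matrix $E \in M_{n+1}(A)$ (rows and columns indexed by k, l ∈ {0,…,n}) by $E_{kl} = a^{n-k}c^{k}\,\binom{n}{l}_{q^2}(-q)^{l}\,b^{l}d^{n-l}$. Then E is idempotent: E·E = E in the matrix ring $M_{n+1}(A)$. (E is the projector matrix $e_{-n}$ of the quantum Hopf line bundle of winding number $-n$.) -/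
open Polynomial in
/-- The `x`-shifted factorial `(1 - X)(1 - xX)⋯(1 - x^(m-1)X)`. -/
noncomputable def qShiftedFactorial (x : ℂ) (m : ℕ) : ℂ[X] :=
  ∏ i ∈ Finset.range m, (1 - C (x ^ i) * X)

/-- The `x`-binomial coefficient, defined by the `x`-Pascal recursion. -/
noncomputable def gaussBinom (x : ℂ) : ℕ → ℕ → ℂ
  | _, 0 => 1
  | 0, _ + 1 => 0
  | n + 1, k + 1 => gaussBinom x n (k + 1) + x ^ (n - k) * gaussBinom x n k

theorem gaussBinom_zero_right (x : ℂ) (n : ℕ) : gaussBinom x n 0 = 1 := by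
  cases n <;> rfl

theorem gaussBinom_succ_succ (x : ℂ) (n k : ℕ) :
    gaussBinom x (n + 1) (k + 1) =
      gaussBinom x n (k + 1) + x ^ (n - k) * gaussBinom x n k := rfl

theorem gaussBinom_eq_zero_of_lt (x : ℂ) {n k : ℕ} (h : n < k) : gaussBinom x n k = 0 := by
  induction n generalizing k with
  | zero =>
    obtain ⟨k, rfl⟩ : ∃ j, k = j + 1 := ⟨k - 1, by omega⟩
    rfl
  | succ n ih =>
    obtain ⟨k, rfl⟩ : ∃ j, k = j + 1 := ⟨k - 1, by omega⟩
    rw [gaussBinom_succ_succ, ih (by omega), ih (by omega)]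
    simp

theorem gaussBinom_self (x : ℂ) (n : ℕ) : gaussBinom x n n = 1 := by
  induction n with
  | zero => rfl
  | succ n ih => rw [gaussBinom_succ_succ, gaussBinom_eq_zero_of_lt x (by omega), ih]; simp

theorem gaussBinom_mul_prod (x : ℂ) (m k : ℕ) :
    gaussBinom x (m + k) k * ((∏ i ∈ Finset.range k, (x ^ (i + 1) - 1)) *
      (∏ i ∈ Finset.range m, (x ^ (i + 1) - 1))) =
      ∏ i ∈ Finset.range (m + k), (x ^ (i + 1) - 1) := by
  induction m generalizing k with
  | zero => simp [gaussBinom_self]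
  | succ m ihm =>
    induction k with
    | zero => simp [gaussBinom_zero_right]
    | succ k ihk =>
      have h := ihm (k + 1)
      rw [show m + (k + 1) = m + 1 + k by ring] at h
      rw [← add_assoc, gaussBinom_succ_succ, show m + 1 + k - k = m + 1 by omega,
        Finset.prod_range_succ _ (m + 1 + k)]
      rw [Finset.prod_range_succ _ k] at h ⊢
      rw [Finset.prod_range_succ _ m] at ihk ⊢
      linear_combination (x ^ (m + 1) - 1) * h + x ^ (m + 1) * (x ^ (k + 1) - 1) * ihk

theorem qbin_eq_gaussBinom {x : ℂ} (hx : ∀ k : ℕ, 0 < k → x ^ k ≠ 1) {n k : ℕ} (h : k ≤ n) :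
    qbin x n k = gaussBinom x n k := by
  have hD : ∀ m : ℕ, ∏ i ∈ Finset.range m, (x ^ (i + 1) - 1) ≠ 0 := fun m =>
    Finset.prod_ne_zero_iff.mpr fun i _ => sub_ne_zero.mpr (hx (i + 1) i.succ_pos)
  have key := gaussBinom_mul_prod x (n - k) k
  rw [Nat.sub_add_cancel h] at key
  rw [qbin, div_eq_iff (mul_ne_zero (hD _) (hD _)), key]

open Polynomial in
theorem sum_gaussBinom_mul_qShiftedFactorial (x : ℂ) (n : ℕ) :
    ∑ l ∈ Finset.range (n + 1),
      C (gaussBinom x n l) * X ^ l * qShiftedFactorial x (n - l) = 1 := by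
  induction n with
  | zero => simp [qShiftedFactorial, gaussBinom_zero_right]
  | succ n ih =>
    have hP : ∀ m, qShiftedFactorial x (m + 1) =
        qShiftedFactorial x m * (1 - C (x ^ m) * X) := fun m => Finset.prod_range_succ _ _
    have hlow : ∑ l ∈ Finset.range (n + 1),
          C (gaussBinom x n (l + 1)) * X ^ (l + 1) * qShiftedFactorial x (n - l) +
        C (gaussBinom x n 0) * X ^ 0 * qShiftedFactorial x (n + 1) =
        ∑ l ∈ Finset.range (n + 1),
          C (gaussBinom x n l) * X ^ l *
            (qShiftedFactorial x (n - l) * (1 - C (x ^ (n - l)) * X)) := by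
      have h := Finset.sum_range_succ' (fun l =>
        C (gaussBinom x n l) * X ^ l * qShiftedFactorial x (n + 1 - l)) (n + 1)
      simp only [Nat.add_sub_add_right, Nat.sub_zero] at h
      rw [← h, Finset.sum_range_succ, gaussBinom_eq_zero_of_lt x (Nat.lt_succ_self n)]
      simp only [C_0, zero_mul, add_zero]
      refine Finset.sum_congr rfl fun l hl => ?_
      have hl' : l ≤ n := Nat.lt_succ_iff.mp (Finset.mem_range.mp hl)
      rw [Nat.succ_sub hl', hP]
    rw [Finset.sum_range_succ']
    simp only [Nat.add_sub_add_right, Nat.sub_zero, gaussBinom_succ_succ, C_add, add_mul,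
      Finset.sum_add_distrib]
    rw [gaussBinom_zero_right, ← gaussBinom_zero_right x n, add_right_comm, hlow,
      ← Finset.sum_add_distrib]
    refine Eq.trans ?_ ih
    refine Finset.sum_congr rfl fun l _ => ?_
    rw [C_mul]
    ring

open Polynomial in
theorem pow_mul_pow_eq_aeval_qShiftedFactorial {A : Type*} [Ring A] [Algebra ℂ A]
    {x : ℂ} {a d y : A} (hdy : d * y = x • (y * d)) (hda : d * a = 1 - y) (m : ℕ) :
    d ^ m * a ^ m = aeval y (qShiftedFactorial x m) := by
  have hpow : ∀ m : ℕ, d ^ m * y = x ^ m • (y * d ^ m) := by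
    intro m
    induction m with
    | zero => simp
    | succ m ih =>
      rw [pow_succ, mul_assoc, hdy, mul_smul_comm, ← mul_assoc, ih, smul_mul_assoc, smul_smul,
        mul_assoc, pow_succ']
  induction m with
  | zero => simp [qShiftedFactorial]
  | succ m ih =>
    have h : d ^ (m + 1) * a ^ (m + 1) = (1 - x ^ m • y) * (d ^ m * a ^ m) := by
      calc d ^ (m + 1) * a ^ (m + 1) = d ^ m * (d * a) * a ^ m := by
            rw [pow_succ, pow_succ' a]; simp only [mul_assoc]
        _ = _ := by
            rw [hda, mul_sub, hpow, mul_one, sub_mul, sub_mul, one_mul, smul_mul_assoc,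
              smul_mul_assoc, mul_assoc]
    rw [h, ih, qShiftedFactorial, qShiftedFactorial, Finset.prod_range_succ, mul_comm (∏ _ ∈ _, _),
      map_mul]
    simp [Algebra.smul_def]

/-- The row vector `(qbin(n,l) (-q)^l b^l d^(n-l))` times the column `(a^(n-l) c^l)` is `1`. -/
theorem sum_qbin_smul_eq_one {A : Type*} [Ring A] [Algebra ℂ A] {q : ℂ} {a b c d : A}
    (hq : q ≠ 0) (hroot : ∀ k : ℕ, 0 < k → q ^ k ≠ 1)
    (hbd : b * d = q⁻¹ • (d * b)) (hbc : b * c = c * b) (hcd : c * d = q⁻¹ • (d * c))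
    (hda : d * a - q • (b * c) = 1) (n : ℕ) :
    ∑ l ∈ Finset.range (n + 1), (qbin (q ^ 2) n l * (-q) ^ l) •
      (b ^ l * d ^ (n - l) * a ^ (n - l) * c ^ l) = 1 := by
  set y : A := (-q) • (b * c) with hy
  have hdb : d * b = q • (b * d) := by rw [hbd, smul_smul, mul_inv_cancel₀ hq, one_smul]
  have hdc : d * c = q • (c * d) := by rw [hcd, smul_smul, mul_inv_cancel₀ hq, one_smul]
  have hdy : d * y = q ^ 2 • (y * d) := by
    rw [hy, mul_smul_comm, ← mul_assoc, hdb, smul_mul_assoc, mul_assoc, hdc, mul_smul_comm,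
      smul_mul_assoc, smul_smul, smul_smul, smul_smul, mul_assoc, show -q * (q * q) = q ^ 2 * -q by ring,
      mul_assoc]
  have hda' : d * a = 1 - y := by
    rw [hy, neg_smul, sub_neg_eq_add, ← hda, sub_add_cancel]
  have hcy : Commute c y :=
    ((show Commute c b from hbc.symm).mul_right (Commute.refl c)).smul_right _
  have hx : ∀ k : ℕ, 0 < k → (q ^ 2) ^ k ≠ 1 := fun k hk => by
    rw [← pow_mul]; exact hroot _ (by omega)
  have key := congrArg (Polynomial.aeval y) (sum_gaussBinom_mul_qShiftedFactorial (q ^ 2) n)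
  rw [map_sum, map_one] at key
  rw [← key]
  refine Finset.sum_congr rfl fun l hl => ?_
  have hl' : l ≤ n := Nat.lt_succ_iff.mp (Finset.mem_range.mp hl)
  have hcP : Commute (c ^ l) (Polynomial.aeval y (qShiftedFactorial (q ^ 2) (n - l))) := by
    rw [Polynomial.aeval_eq_sum_range]
    exact Commute.sum_right _ _ _ fun i _ => (hcy.pow_pow l i).smul_right _
  rw [mul_assoc (b ^ l), pow_mul_pow_eq_aeval_qShiftedFactorial hdy hda', mul_assoc, ← hcP.eq,
    ← mul_assoc, ← (show Commute b c from hbc).mul_pow, map_mul, map_mul, Polynomial.aeval_C,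
    map_pow, Polynomial.aeval_X, qbin_eq_gaussBinom hx hl', mul_smul, ← Algebra.smul_def,
    hy, smul_pow, smul_mul_assoc, smul_mul_assoc]

theorem stmt12 (q : ℂ) (hq : q ≠ 0) (hroot : ∀ k : ℕ, 0 < k → q ^ k ≠ 1)
    (A : Type*) [Ring A] [Algebra ℂ A] (a b c d : A)
    (hab : a * b = q⁻¹ • (b * a)) (hac : a * c = q⁻¹ • (c * a))
    (hbd : b * d = q⁻¹ • (d * b)) (hbc : b * c = c * b)
    (hcd : c * d = q⁻¹ • (d * c))
    (hadda : a * d - d * a = (q⁻¹ - q) • (b * c))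
    (had : a * d - q⁻¹ • (b * c) = 1) (hda : d * a - q • (b * c) = 1)
    (n : ℕ) (E : Matrix (Fin (n + 1)) (Fin (n + 1)) A)
    (hE : ∀ k l : Fin (n + 1), E k l =
      (qbin (q ^ 2) n l * (-q) ^ (l : ℕ)) •
        (a ^ (n - (k : ℕ)) * c ^ (k : ℕ) * b ^ (l : ℕ) * d ^ (n - (l : ℕ)))) :
    E * E = E := by
  ext k l
  have h := sum_qbin_smul_eq_one hq hroot hbd hbc hcd hda n
  rw [← Fin.sum_univ_eq_sum_range (fun j => (qbin (q ^ 2) n j * (-q) ^ j) •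
    (b ^ j * d ^ (n - j) * a ^ (n - j) * c ^ j))] at h
  calc (E * E) k l = (qbin (q ^ 2) n l * (-q) ^ (l : ℕ)) •
        (a ^ (n - (k : ℕ)) * c ^ (k : ℕ) *
          (∑ j : Fin (n + 1), (qbin (q ^ 2) n j * (-q) ^ (j : ℕ)) •
            (b ^ (j : ℕ) * d ^ (n - (j : ℕ)) * a ^ (n - (j : ℕ)) * c ^ (j : ℕ))) *
          (b ^ (l : ℕ) * d ^ (n - (l : ℕ)))) := by
        rw [Matrix.mul_apply, Finset.mul_sum, Finset.sum_mul, Finset.smul_sum]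
        refine Finset.sum_congr rfl fun j _ => ?_
        rw [hE, hE]
        simp only [mul_smul_comm, smul_mul_assoc, mul_assoc]
    _ = E k l := by rw [h, hE, mul_one, mul_assoc _ (b ^ _)]
end
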